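/- Let (X,𝓑,m,T) be a log-lower bounded, conservative, ergodic, measure-preserving transformation of a σ-finite measure space, and let 𝓒 ⊆ 𝓑 be a factor, i.e. a T-invariant sub-σ-algebra (T⁻¹𝓒 = 𝓒 mod m) on which m is σ-finite. Then 𝓒 ∩ 𝓕_{log,T} ≠ ∅, i.e. there exists A ∈ 𝓒 with 0 < m(A) < ∞ and ∫_A log φ_A dm < ∞. -/

import Mathlib

open MeasureTheory
open scoped ENNReal symmDiff

/-- The first return time `φ_A(x) = min {n ≥ 1 : Tⁿ x ∈ A}` (with value `0` if there is no
such `n`). -/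
noncomputable def returnTime {X : Type*} (T : X → X) (A : Set X) (x : X) : ℕ :=
  sInf {n : ℕ | 1 ≤ n ∧ T^[n] x ∈ A}

/-- `T` is log-lower bounded (LLB): there is a set `A` with `0 < m A < ∞` and
`∫_A log φ_A dm < ∞`, i.e. `𝓕_{log,T} ≠ ∅`. -/
def LLB {X : Type*} [MeasurableSpace X] (T : X → X) (m : Measure X) : Prop :=
  ∃ A : Set X, MeasurableSet A ∧ 0 < m A ∧ m A < ⊤ ∧
    ∫⁻ x in A, ENNReal.ofReal (Real.log (returnTime T A x)) ∂m < ⊤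


/-- First positive index of a sequence of sets containing the point. -/
noncomputable def firstIdx {X : Type*} (S : ℕ → Set X) (x : X) : ℕ :=
  sInf {n : ℕ | 1 ≤ n ∧ x ∈ S n}

lemma firstIdx_measurable {X : Type*} [MeasurableSpace X] (S : ℕ → Set X)
    (hS : ∀ n, MeasurableSet (S n)) : Measurable (firstIdx S) := by
  have key : ∀ k : ℕ, 1 ≤ k → MeasurableSet (firstIdx S ⁻¹' {k}) := by
    intro k hk
    have : firstIdx S ⁻¹' {k} = S k ∩ ⋂ j ∈ Finset.Ico 1 k, (S j)ᶜ := by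
      ext x
      simp only [Set.mem_preimage, Set.mem_singleton_iff, Set.mem_inter_iff, Set.mem_iInter,
        Finset.mem_Ico, Set.mem_compl_iff]
      constructor
      · intro h
        have hne : {n : ℕ | 1 ≤ n ∧ x ∈ S n}.Nonempty := by
          by_contra hcon
          rw [Set.not_nonempty_iff_eq_empty] at hcon
          unfold firstIdx at h
          rw [hcon, Nat.sInf_empty] at h
          omega
        have h1 := Nat.sInf_mem hne
        change 1 ≤ firstIdx S x ∧ x ∈ S (firstIdx S x) at h1
        rw [h] at h1
        refine ⟨h1.2, fun j hj hxj => ?_⟩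
        have : firstIdx S x ≤ j := Nat.sInf_le ⟨hj.1, hxj⟩
        omega
      · rintro ⟨h1, h2⟩
        have hle : firstIdx S x ≤ k := Nat.sInf_le ⟨hk, h1⟩
        have h3 : 1 ≤ firstIdx S x ∧ x ∈ S (firstIdx S x) :=
          Nat.sInf_mem (s := {n : ℕ | 1 ≤ n ∧ x ∈ S n}) ⟨k, hk, h1⟩
        by_contra hne
        exact h2 _ ⟨h3.1, by omega⟩ h3.2
    rw [this]
    exact (hS k).inter (Finset.measurableSet_biInter _ fun j _ => (hS j).compl)
  apply measurable_to_countable'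
  intro k
  rcases Nat.eq_zero_or_pos k with rfl | hk
  · have : firstIdx S ⁻¹' {0} = (⋃ k ∈ {k : ℕ | 1 ≤ k}, firstIdx S ⁻¹' {k})ᶜ := by
      ext x
      simp only [Set.mem_preimage, Set.mem_singleton_iff, Set.mem_compl_iff, Set.mem_iUnion,
        exists_prop, not_exists, not_and]
      constructor
      · intro h k hk h'
        have hk' : 1 ≤ k := hk
        omega
      · intro h
        by_contra hne
        exact h _ (show 1 ≤ firstIdx S x by omega) rfl
    rw [this]
    exact (MeasurableSet.biUnion (Set.to_countable _) fun k hk => key k hk).compl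
  · exact key k hk

lemma returnTime_eq {X : Type*} (T : X → X) (A : Set X) :
    returnTime T A = firstIdx (fun n => T^[n] ⁻¹' A) := rfl

/-- The function `1_A log (1 + φ_A)`. -/
noncomputable def gfun {X : Type*} (T : X → X) (A : Set X) (x : X) : ℝ :=
  A.indicator (fun z => Real.log (1 + returnTime T A z)) x

lemma gfun_nonneg {X : Type*} (T : X → X) (A : Set X) (x : X) : 0 ≤ gfun T A x := by
  unfold gfun
  apply Set.indicator_nonneg
  intro z _
  apply Real.log_nonneg
  have : (0 : ℝ) ≤ returnTime T A z := Nat.cast_nonneg _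
  linarith

lemma log_le_sum {X : Type*} (T : X → X) (A : Set X) :
    ∀ (N : ℕ) (y : X), y ∈ A → T^[N] y ∈ A →
      Real.log (1 + N) ≤ ∑ n ∈ Finset.range N, gfun T A (T^[n] y) := by
  intro N
  induction N using Nat.strong_induction_on with
  | _ N ih =>
    intro y hy hN
    rcases Nat.eq_zero_or_pos N with rfl | hpos
    · simp
    · have hmem : 1 ≤ returnTime T A y ∧ T^[returnTime T A y] y ∈ A :=
        Nat.sInf_mem (s := {n : ℕ | 1 ≤ n ∧ T^[n] y ∈ A}) ⟨N, hpos, hN⟩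
      have hle : returnTime T A y ≤ N := Nat.sInf_le ⟨hpos, hN⟩
      have hg : gfun T A y = Real.log (1 + returnTime T A y) := by
        simp [gfun, hy]
      obtain ⟨h1, h2⟩ := hmem
      generalize returnTime T A y = k at *
      obtain ⟨M, rfl⟩ := Nat.exists_eq_add_of_le hle
      have h3 := ih M (by omega) (T^[k] y) h2 (by
        rw [← Function.iterate_add_apply, add_comm]; exact hN)
      rw [Finset.sum_range_add]
      have h4 : gfun T A y ≤ ∑ n ∈ Finset.range k, gfun T A (T^[n] y) := by
        have := Finset.single_le_sum (f := fun n => gfun T A (T^[n] y)) (s := Finset.range k)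
          (fun i _ => gfun_nonneg T A _) (Finset.mem_range.2 (by omega : 0 < k))
        simpa using this
      have h5 : ∑ n ∈ Finset.range M, gfun T A (T^[k + n] y)
          = ∑ n ∈ Finset.range M, gfun T A (T^[n] (T^[k] y)) := by
        apply Finset.sum_congr rfl
        intro n _
        rw [← Function.iterate_add_apply, add_comm]
      rw [h5]
      have hk0 : (0 : ℝ) ≤ k := Nat.cast_nonneg _
      have hM0 : (0 : ℝ) ≤ M := Nat.cast_nonneg _
      have h6 : Real.log (1 + (k + M : ℕ)) ≤ Real.log (1 + k) + Real.log (1 + M) := by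
        rw [← Real.log_mul (by positivity) (by positivity)]
        apply Real.log_le_log (by positivity)
        push_cast
        nlinarith [mul_nonneg hk0 hM0]
      linarith

/-- Points of `B` which do not come back to `B` up to time `n`. -/
def stayOut {X : Type*} (T : X → X) (B : Set X) (n : ℕ) : Set X :=
  B ∩ {x | ∀ j, 1 ≤ j → j ≤ n → T^[j] x ∉ B}

lemma stayOut_measurable {X : Type*} [MeasurableSpace X] {T : X → X} (hT : Measurable T)
    {B : Set X} (hB : MeasurableSet B) (n : ℕ) : MeasurableSet (stayOut T B n) := by
  have : stayOut T B n = B ∩ ⋂ j ∈ Finset.Icc 1 n, (T^[j] ⁻¹' B)ᶜ := by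
    ext x
    simp [stayOut]
  rw [this]
  exact hB.inter (Finset.measurableSet_biInter _ fun j _ => ((hT.iterate j) hB).compl)

/-- The measures on the levels of the tower over `B`. -/
noncomputable def tower {X : Type*} [MeasurableSpace X] (T : X → X) (m : Measure X)
    (B : Set X) (n : ℕ) : Measure X :=
  (m.restrict (stayOut T B n)).map (T^[n])

lemma tower_zero {X : Type*} [MeasurableSpace X] (T : X → X) (m : Measure X)
    (B : Set X) : tower T m B 0 = m.restrict B := by
  have : stayOut T B 0 = B := by
    ext x
    simp only [stayOut, Set.mem_inter_iff, Set.mem_ofPred_eq, and_iff_left_iff_imp]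
    intro _ j h1 h2
    omega
  simp [tower, this]

lemma tower_succ {X : Type*} [MeasurableSpace X] {T : X → X} (hT : Measurable T)
    (m : Measure X) {B : Set X} (hB : MeasurableSet B) (n : ℕ) :
    tower T m B (n + 1) = ((tower T m B n).map T).restrict Bᶜ := by
  ext E hE
  unfold tower
  rw [Measure.restrict_apply hE, Measure.map_apply hT (hE.inter hB.compl),
    Measure.map_apply (hT.iterate n) (hT (hE.inter hB.compl)),
    Measure.map_apply (hT.iterate _) hE,
    Measure.restrict_apply (hT.iterate _ hE),
    Measure.restrict_apply ((hT.iterate n) (hT (hE.inter hB.compl)))]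
  congr 1
  ext x
  simp only [stayOut, Set.mem_inter_iff, Set.mem_preimage, Set.mem_ofPred_eq, Set.mem_compl_iff,
    ← Function.iterate_succ_apply' T]
  constructor
  · rintro ⟨h1, h2, h3⟩
    exact ⟨⟨h1, h3 _ (by omega) le_rfl⟩, h2, fun j hj hj' => h3 j hj (by omega)⟩
  · rintro ⟨⟨h1, h4⟩, h2, h3⟩
    refine ⟨h1, h2, fun j hj hj' => ?_⟩
    rcases Nat.lt_or_ge n j with h | h
    · obtain rfl : j = n + 1 := by omega
      exact h4
    · exact h3 j hj h

lemma tower_sum_le {X : Type*} [MeasurableSpace X] {T : X → X} {m : Measure X}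
    (hT : MeasurePreserving T m m) {B : Set X} (hB : MeasurableSet B) (N : ℕ) :
    ∀ E, MeasurableSet E → ∑ n ∈ Finset.range N, tower T m B n E ≤ m E := by
  induction N with
  | zero => simp
  | succ N ih =>
    intro E hE
    rw [Finset.sum_range_succ', tower_zero, Measure.restrict_apply hE]
    have h : ∀ n, tower T m B (n + 1) E = tower T m B n (T ⁻¹' (E ∩ Bᶜ)) := by
      intro n
      rw [tower_succ hT.measurable m hB, Measure.restrict_apply hE,
        Measure.map_apply hT.measurable (hE.inter hB.compl)]
    simp only [h]
    calc _ ≤ m (T ⁻¹' (E ∩ Bᶜ)) + m (E ∩ B) := by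
          gcongr
          exact ih _ (hT.measurable (hE.inter hB.compl))
      _ = m (E ∩ Bᶜ) + m (E ∩ B) := by
          rw [hT.measure_preimage (hE.inter hB.compl).nullMeasurableSet]
      _ = m E := by
          rw [add_comm, ← Set.sdiff_eq, measure_inter_add_sdiff _ hB]

lemma kac_le {X : Type*} [MeasurableSpace X] {T : X → X} {m : Measure X}
    (hT : MeasurePreserving T m m) {B : Set X} (hB : MeasurableSet B) {g : X → ℝ≥0∞}
    (hg : Measurable g) :
    ∫⁻ x, ∑' n, (stayOut T B n).indicator (fun x => g (T^[n] x)) x ∂m ≤ ∫⁻ x, g x ∂m := by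
  rw [lintegral_tsum (f := fun n => (stayOut T B n).indicator (fun x => g (T^[n] x)))
    (fun n => ((hg.comp (hT.measurable.iterate n)).indicator
      (stayOut_measurable hT.measurable hB n)).aemeasurable)]
  have h : ∀ n, ∫⁻ x, (stayOut T B n).indicator (fun x => g (T^[n] x)) x ∂m
      = ∫⁻ x, g x ∂(tower T m B n) := by
    intro n
    rw [lintegral_indicator (stayOut_measurable hT.measurable hB n), tower,
      lintegral_map hg (hT.measurable.iterate n)]
  simp only [h]
  rw [← lintegral_sum_measure]
  apply lintegral_mono' _ le_rfl
  rw [Measure.le_iff]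
  intro E hE
  rw [Measure.sum_apply _ hE, ENNReal.tsum_eq_iSup_nat]
  exact iSup_le fun N => tower_sum_le hT hB N E hE

lemma returnTime_measurable {X : Type*} [MeasurableSpace X] {T : X → X} (hT : Measurable T)
    {A : Set X} (hA : MeasurableSet A) : Measurable (returnTime T A) := by
  rw [returnTime_eq]
  exact firstIdx_measurable _ fun n => hT.iterate n hA

lemma gfun_measurable {X : Type*} [MeasurableSpace X] {T : X → X} (hT : Measurable T)
    {A : Set X} (hA : MeasurableSet A) : Measurable (gfun T A) := by
  unfold gfun
  refine Measurable.indicator ?_ hA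
  exact (measurable_from_nat (f := fun n : ℕ => Real.log (1 + n))).comp (returnTime_measurable hT hA)

lemma hereditary {X : Type*} [MeasurableSpace X] {T : X → X} {m : Measure X}
    (hT : MeasurePreserving T m m) {A B : Set X} (hA : MeasurableSet A) (hB : MeasurableSet B)
    (hBA : B ⊆ A) (hfin : m A < ⊤)
    (hlog : ∫⁻ x in A, ENNReal.ofReal (Real.log (returnTime T A x)) ∂m < ⊤) :
    ∫⁻ x in B, ENNReal.ofReal (Real.log (returnTime T B x)) ∂m < ⊤ := by
  have h1 : ∫⁻ x in B, ENNReal.ofReal (Real.log (returnTime T B x)) ∂m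
      ≤ ∫⁻ x, ENNReal.ofReal (gfun T A x) ∂m := by
    refine le_trans ?_ (kac_le hT hB (gfun_measurable hT.measurable hA).ennreal_ofReal)
    rw [← lintegral_indicator hB]
    apply lintegral_mono
    intro x
    by_cases hx : x ∈ B
    swap
    · simp [hx]
    simp only [hx, Set.indicator_of_mem]
    rcases Nat.eq_zero_or_pos (returnTime T B x) with h0 | h0
    · simp [h0]
    have hne : {n : ℕ | 1 ≤ n ∧ T^[n] x ∈ B}.Nonempty := by
      by_contra hcon
      rw [Set.not_nonempty_iff_eq_empty] at hcon
      unfold returnTime at h0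
      rw [hcon, Nat.sInf_empty] at h0
      omega
    have hmem : 1 ≤ returnTime T B x ∧ T^[returnTime T B x] x ∈ B := Nat.sInf_mem hne
    have hl := log_le_sum T A _ x (hBA hx) (hBA hmem.2)
    calc ENNReal.ofReal (Real.log (returnTime T B x))
        ≤ ENNReal.ofReal (∑ n ∈ Finset.range (returnTime T B x), gfun T A (T^[n] x)) := by
          apply ENNReal.ofReal_le_ofReal
          refine le_trans (Real.log_le_log (by exact_mod_cast h0) ?_) hl
          linarith
      _ = ∑ n ∈ Finset.range (returnTime T B x), ENNReal.ofReal (gfun T A (T^[n] x)) :=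
          ENNReal.ofReal_sum_of_nonneg fun _ _ => gfun_nonneg _ _ _
      _ = ∑ n ∈ Finset.range (returnTime T B x),
            (stayOut T B n).indicator (fun x => ENNReal.ofReal (gfun T A (T^[n] x))) x := by
          apply Finset.sum_congr rfl
          intro n hn
          rw [Set.indicator_of_mem]
          refine ⟨hx, fun j hj hj' hjB => ?_⟩
          have : returnTime T B x ≤ j := Nat.sInf_le ⟨hj, hjB⟩
          have := Finset.mem_range.1 hn
          omega
      _ ≤ _ := ENNReal.sum_le_tsum _
  refine lt_of_le_of_lt h1 ?_
  have h2 : ∫⁻ x, ENNReal.ofReal (gfun T A x) ∂m ≤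
      ∫⁻ x in A, (ENNReal.ofReal (Real.log 2) +
        ENNReal.ofReal (Real.log (returnTime T A x))) ∂m := by
    rw [← lintegral_indicator hA]
    apply lintegral_mono
    intro x
    by_cases hx : x ∈ A
    swap
    · simp [hx, gfun]
    simp only [gfun, hx, Set.indicator_of_mem]
    rcases Nat.eq_zero_or_pos (returnTime T A x) with h0 | h0
    · simp [h0]
    have h0' : (1 : ℝ) ≤ returnTime T A x := by exact_mod_cast h0
    rw [← ENNReal.ofReal_add (Real.log_nonneg (by norm_num)) (Real.log_nonneg h0')]
    apply ENNReal.ofReal_le_ofReal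
    rw [← Real.log_mul (by norm_num) (by positivity)]
    apply Real.log_le_log (by positivity)
    linarith
  refine lt_of_le_of_lt h2 ?_
  rw [lintegral_add_left measurable_const, setLIntegral_const]
  exact ENNReal.add_lt_top.2 ⟨ENNReal.mul_lt_top ENNReal.ofReal_lt_top hfin, hlog⟩

/-- A conditional-expectation substitute: a set `K` in the sub-sigma-algebra on which the
conditional probability of `A` is at least `ε`. -/
lemma exists_K {X : Type*} [ms : MeasurableSpace X] (m : Measure X)
    (C : MeasurableSpace X) (hCle : C ≤ ms) (hsf : SigmaFinite (m.trim hCle))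
    {A : Set X} (hA0 : 0 < m A) (hA1 : m A < ⊤) :
    ∃ (K : Set X) (ε : ℝ≥0∞), MeasurableSet[C] K ∧ ε ≠ 0 ∧ ε ≠ ⊤ ∧ 0 < m K ∧
      ∀ f : X → ℝ≥0∞, Measurable[C] f → ε * ∫⁻ x in K, f x ∂m ≤ ∫⁻ x in A ∩ K, f x ∂m := by
  have hfm : IsFiniteMeasure (m.restrict A) := ⟨by simpa using hA1⟩
  set μ : @Measure X C := m.trim hCle with hμ
  set ν : @Measure X C := (m.restrict A).trim hCle with hν
  have hac : ν ≪ μ := by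
    refine @Measure.AbsolutelyContinuous.mk X C _ _ fun s hs h => ?_
    rw [trim_measurableSet_eq hCle hs] at h ⊢
    exact Measure.absolutelyContinuous_of_le Measure.restrict_le_self h
  have hνf : @IsFiniteMeasure X C ν := isFiniteMeasure_trim hCle
  set h : X → ℝ≥0∞ := @Measure.rnDeriv X C ν μ with hh
  have hhm : Measurable[C] h := @Measure.measurable_rnDeriv X C ν μ
  have hwd : @Measure.withDensity X C μ h = ν := @Measure.withDensity_rnDeriv_eq X C ν μ _ hac
  have key : ∀ f : X → ℝ≥0∞, Measurable[C] f →
      ∫⁻ x in A, f x ∂m = ∫⁻ x, h x * f x ∂m := by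
    intro f hf
    rw [← lintegral_trim hCle hf, ← lintegral_trim hCle (f := fun x => h x * f x) (hhm.mul hf), ← hν, ← hwd]
    exact @lintegral_withDensity_eq_lintegral_mul X C μ h hhm f hf
  have hex : ∃ n : ℕ, 0 < m {x | ((n : ℝ≥0∞) + 1)⁻¹ ≤ h x} := by
    by_contra hcon
    push Not at hcon
    have hz : m (⋃ n : ℕ, {x | ((n : ℝ≥0∞) + 1)⁻¹ ≤ h x}) = 0 :=
      measure_iUnion_null fun n => le_antisymm (hcon n) (zero_le)
    have hae : ∀ᵐ x ∂m, h x = 0 := by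
      rw [ae_iff]
      refine measure_mono_null ?_ hz
      intro x hx
      obtain ⟨n, hn⟩ := ENNReal.exists_inv_nat_lt hx
      refine Set.mem_iUnion.2 ⟨n, le_trans ?_ hn.le⟩
      exact ENNReal.inv_le_inv.2 le_self_add
    have h1 := key (fun _ => 1) measurable_const
    have h2 : ∫⁻ x, h x * 1 ∂m = 0 := by
      rw [lintegral_congr_ae (g := fun _ => 0)]
      · simp
      · filter_upwards [hae] with x hx
        simp [hx]
    rw [h2] at h1
    simp at h1
    rw [h1] at hA0
    exact lt_irrefl _ hA0
  obtain ⟨n, hn⟩ := hex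
  have hK : MeasurableSet[C] {x | ((n : ℝ≥0∞) + 1)⁻¹ ≤ h x} := hhm measurableSet_Ici
  refine ⟨_, ((n : ℝ≥0∞) + 1)⁻¹, hK, ?_, ?_, hn, ?_⟩
  · simp
  · simp
  intro f hf
  have hK' := hCle _ hK
  set K := {x | ((n : ℝ≥0∞) + 1)⁻¹ ≤ h x} with hKd
  have h1 : ∫⁻ x in A ∩ K, f x ∂m = ∫⁻ x in A, K.indicator f x ∂m := by
    rw [lintegral_indicator hK', Measure.restrict_restrict hK', Set.inter_comm]
  rw [h1, key _ (hf.indicator hK), ← lintegral_indicator hK',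
    ← lintegral_const_mul _ ((hf.mono hCle le_rfl).indicator hK')]
  apply lintegral_mono
  intro x
  by_cases hx : x ∈ K
  · simp only [hx, Set.indicator_of_mem]
    gcongr
    exact hx
  · simp [hx]

/-- Proposition 2.2(iii): if `T` is LLB, conservative, ergodic and measure
preserving and `𝓒 ⊆ 𝓑` is a factor (a `T`-invariant sub-σ-algebra, `T⁻¹𝓒 = 𝓒 mod m`, on
which `m` is σ-finite), then `𝓒 ∩ 𝓕_{log,T} ≠ ∅`: there is `A ∈ 𝓒` with `0 < m A < ∞`
and `∫_A log φ_A dm < ∞`. -/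
theorem stmt_6 {X : Type*} [ms : MeasurableSpace X] (m : Measure X) [SigmaFinite m]
    (T : X → X) (hc : Conservative T m) (he : Ergodic T m)
    (hLLB : LLB T m)
    (C : MeasurableSpace X) (hCle : C ≤ ms)
    (hsf : SigmaFinite (m.trim hCle))
    (hinv1 : ∀ s : Set X, MeasurableSet[C] s →
      ∃ s' : Set X, MeasurableSet[C] s' ∧ m ((T ⁻¹' s) ∆ s') = 0)
    (hinv2 : ∀ s : Set X, MeasurableSet[C] s →
      ∃ s' : Set X, MeasurableSet[C] s' ∧ m (s ∆ (T ⁻¹' s')) = 0) :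
    ∃ A : Set X, MeasurableSet[C] A ∧ 0 < m A ∧ m A < ⊤ ∧
      ∫⁻ x in A, ENNReal.ofReal (Real.log (returnTime T A x)) ∂m < ⊤ := by
  obtain ⟨A, hA, hA0, hA1, hlog⟩ := hLLB
  obtain ⟨K, ε, hK, hε0, hεt, hK0, hKf⟩ :=
    @exists_K X ms m C hCle hsf A hA0 hA1
  have hT : @MeasurePreserving X X ms ms T m m := he.toMeasurePreserving
  have hKm : MeasurableSet[ms] K := hCle _ hK
  have hB : MeasurableSet[ms] (A ∩ K) := hA.inter hKm
  -- finite measure of K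
  have hKfin : m K < ⊤ := by
    have h1 := hKf (fun _ => 1) measurable_const
    simp only [setLIntegral_const, one_mul] at h1
    have h2 : ε * m K < ⊤ := lt_of_le_of_lt h1
      (lt_of_le_of_lt (measure_mono Set.inter_subset_left) hA1)
    by_contra hcon
    rw [not_lt, top_le_iff] at hcon
    rw [hcon, ENNReal.mul_top hε0] at h2
    exact lt_irrefl _ h2
  refine ⟨K, hK, hK0, hKfin, ?_⟩
  -- C-measurable versions of the preimages
  have hS : ∀ n : ℕ, ∃ S : Set X, MeasurableSet[C] S ∧ (T^[n] ⁻¹' K) =ᵐ[m] S := by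
    intro n
    induction n with
    | zero => exact ⟨K, hK, Filter.EventuallyEq.rfl⟩
    | succ n ih =>
      obtain ⟨S, hS, hSe⟩ := ih
      obtain ⟨S', hS', hSe'⟩ := hinv1 S hS
      refine ⟨S', hS', ?_⟩
      have h1 : T ⁻¹' (T^[n] ⁻¹' K) =ᵐ[m] T ⁻¹' S :=
        @Measure.QuasiMeasurePreserving.preimage_ae_eq X X ms ms m m T _ _
          (@MeasurePreserving.quasiMeasurePreserving X X ms ms m m T hT) hSe
      have h2 : T ⁻¹' S =ᵐ[m] S' := measure_symmDiff_eq_zero_iff.1 hSe'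
      exact h1.trans h2
  choose S hSm hSe using hS
  have hfi : ∀ᵐ x ∂m, returnTime T K x = firstIdx S x := by
    have : ∀ᵐ x ∂m, ∀ n, (x ∈ T^[n] ⁻¹' K ↔ x ∈ S n) :=
      ae_all_iff.2 fun n => (hSe n).mem_iff
    filter_upwards [this] with x hx
    rw [returnTime_eq]
    unfold firstIdx
    simp only [hx]
  have hfC : Measurable[C] (fun x => ENNReal.ofReal (Real.log (firstIdx S x))) :=
    (measurable_from_nat (f := fun n : ℕ => ENNReal.ofReal (Real.log n))).comp
      (@firstIdx_measurable X C S hSm)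
  have hmain := hKf _ hfC
  have hrec : ∀ᵐ x ∂m, x ∈ A ∩ K → ∃ᶠ n in Filter.atTop, T^[n] x ∈ A ∩ K :=
    @Conservative.ae_mem_imp_frequently_image_mem X ms T (A ∩ K) m hc
      (@MeasurableSet.nullMeasurableSet X ms m _ hB)
  have hle : ∫⁻ x in A ∩ K, ENNReal.ofReal (Real.log (firstIdx S x)) ∂m ≤
      ∫⁻ x in A ∩ K, ENNReal.ofReal (Real.log (returnTime T (A ∩ K) x)) ∂m := by
    apply lintegral_mono_ae
    rw [ae_restrict_iff' hB]
    filter_upwards [hrec, hfi] with x hx hfx hxB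
    rw [← hfx]
    obtain ⟨N, hN1, hN⟩ := (Filter.frequently_atTop.1 (hx hxB)) 1
    have h1 : 1 ≤ returnTime T (A ∩ K) x ∧ T^[returnTime T (A ∩ K) x] x ∈ A ∩ K :=
      Nat.sInf_mem (s := {n : ℕ | 1 ≤ n ∧ T^[n] x ∈ A ∩ K}) ⟨N, hN1, hN⟩
    have h2 : 1 ≤ returnTime T K x ∧ T^[returnTime T K x] x ∈ K :=
      Nat.sInf_mem (s := {n : ℕ | 1 ≤ n ∧ T^[n] x ∈ K}) ⟨N, hN1, hN.2⟩
    have h3 : returnTime T K x ≤ returnTime T (A ∩ K) x := Nat.sInf_le ⟨h1.1, h1.2.2⟩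
    apply ENNReal.ofReal_le_ofReal
    apply Real.log_le_log
    · exact_mod_cast h2.1
    · exact_mod_cast h3
  have hfinB := @hereditary X ms T m hT A (A ∩ K) hA hB Set.inter_subset_left hA1 hlog
  have heq : ∫⁻ x in K, ENNReal.ofReal (Real.log (returnTime T K x)) ∂m
      = ∫⁻ x in K, ENNReal.ofReal (Real.log (firstIdx S x)) ∂m := by
    apply lintegral_congr_ae
    filter_upwards [ae_restrict_of_ae hfi] with x hx
    rw [hx]
  rw [heq]
  have h2 := lt_of_le_of_lt (hmain.trans hle) hfinB
  by_contra hcon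
  rw [not_lt, top_le_iff] at hcon
  rw [hcon, ENNReal.mul_top hε0] at h2
  exact lt_irrefl _ h2
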